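/- Let f(X,Y) = Y⁴ − 2XY² + 2X² ∈ ℝ[X,Y] (so d = deg_X f = 2 and m = deg_Y f = 4). For every N ∈ ℕ₀, the coefficient polynomial b_{N+1}(Y,Z) equals Y²·((N+2)Y² − 2Z²), and there exists no N ∈ ℕ₀ such that b_{N+1} ≥ 0 on C; in particular, there is no N ∈ ℕ₀ such that b_j ≥ 0 on C for all 0 ≤ j ≤ N + 2. -/

import Mathlib

open Finset

/-- The homogenization-lift `F ∈ ℝ[W,X,Y,Z]` of `f ∈ ℝ[X,Y]` (variables `W=0, X=1, Y=2, Z=3`):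
`F = Σ_{0≤i≤m} Σ_{0≤j≤d} a_{ji} X^j (W+X)^{d−j} Y^i Z^{m−i}`. -/
noncomputable def Fhom (d m : ℕ) (f : MvPolynomial (Fin 2) ℝ) : MvPolynomial (Fin 4) ℝ :=
  ∑ i ∈ range (m + 1), ∑ j ∈ range (d + 1),
    MvPolynomial.C (MvPolynomial.coeff (Finsupp.single 0 j + Finsupp.single 1 i) f) *
      MvPolynomial.X 1 ^ j * (MvPolynomial.X 0 + MvPolynomial.X 1) ^ (d - j) *
      MvPolynomial.X 2 ^ i * MvPolynomial.X 3 ^ (m - i)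

/-- `b : ℕ → ℝ[Y,Z]` (variables `Y=0, Z=1`) is the family of coefficient polynomials defined by
`(W+X)^N F = Σ_{0≤j≤N+d} b_j(Y,Z) W^j X^{N+d−j}`. -/
def bFamily (d m N : ℕ) (f : MvPolynomial (Fin 2) ℝ)
    (b : ℕ → MvPolynomial (Fin 2) ℝ) : Prop :=
  (MvPolynomial.X 0 + MvPolynomial.X 1 : MvPolynomial (Fin 4) ℝ) ^ N * Fhom d m f =
    ∑ j ∈ range (N + d + 1),
      MvPolynomial.rename (![2, 3] : Fin 2 → Fin 4) (b j) *
        MvPolynomial.X 0 ^ j * MvPolynomial.X 1 ^ (N + d - j)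

/-- The polynomial `Y⁴ − 2XY² + 2X²`, with `X = X 0` and `Y = X 1`. -/
noncomputable abbrev quarticPoly : MvPolynomial (Fin 2) ℝ :=
  (MvPolynomial.X 1) ^ 4 - 2 * MvPolynomial.X 0 * (MvPolynomial.X 1) ^ 2
    + 2 * (MvPolynomial.X 0) ^ 2

lemma single_add_single_inj (a b c d : ℕ) :
    (Finsupp.single 0 a + Finsupp.single 1 b : Fin 2 →₀ ℕ) =
      Finsupp.single 0 c + Finsupp.single 1 d ↔ a = c ∧ b = d := by
  simp [Finsupp.ext_iff, Fin.forall_fin_two]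

lemma monomial_single_add_single (a b : ℕ) (r : ℝ) :
    MvPolynomial.monomial (Finsupp.single 0 a + Finsupp.single 1 b : Fin 2 →₀ ℕ) r =
      MvPolynomial.C r * MvPolynomial.X 0 ^ a * MvPolynomial.X 1 ^ b := by
  rw [MvPolynomial.X_pow_eq_monomial, MvPolynomial.X_pow_eq_monomial, mul_assoc,
    MvPolynomial.monomial_mul, MvPolynomial.C_mul_monomial]
  simp

lemma quarticPoly_eq_monomials :
    quarticPoly =
      MvPolynomial.monomial (Finsupp.single 0 0 + Finsupp.single 1 4) 1
        - MvPolynomial.monomial (Finsupp.single 0 1 + Finsupp.single 1 2) 2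
        + MvPolynomial.monomial (Finsupp.single 0 2 + Finsupp.single 1 0) 2 := by
  simp only [monomial_single_add_single, quarticPoly, map_ofNat, map_one]
  ring

lemma coeff_quarticPoly (j i : ℕ) :
    MvPolynomial.coeff (Finsupp.single 0 j + Finsupp.single 1 i) quarticPoly =
      (if 0 = j ∧ 4 = i then 1 else 0) - (if 1 = j ∧ 2 = i then 2 else 0)
        + (if 2 = j ∧ 0 = i then 2 else 0) := by
  rw [quarticPoly_eq_monomials]
  simp only [MvPolynomial.coeff_add, MvPolynomial.coeff_sub, MvPolynomial.coeff_monomial,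
    single_add_single_inj]

lemma mem_support_quarticPoly {s : Fin 2 →₀ ℕ} (hs : s ∈ quarticPoly.support) :
    s 0 ≤ 2 ∧ s 1 ≤ 4 := by
  have h : s = Finsupp.single 0 (s 0) + Finsupp.single 1 (s 1) := by
    simp [Finsupp.ext_iff, Fin.forall_fin_two]
  rw [MvPolynomial.mem_support_iff, h, coeff_quarticPoly] at hs
  contrapose! hs
  rw [if_neg (by omega), if_neg (by omega), if_neg (by omega)]
  norm_num

lemma degreeOf_zero_quarticPoly : quarticPoly.degreeOf 0 = 2 := by
  refine le_antisymm (MvPolynomial.degreeOf_le_iff.2 fun s hs => (mem_support_quarticPoly hs).1) ?_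
  have h : (Finsupp.single 0 2 + Finsupp.single 1 0 : Fin 2 →₀ ℕ) ∈ quarticPoly.support := by
    rw [MvPolynomial.mem_support_iff, coeff_quarticPoly]
    norm_num
  simpa using MvPolynomial.monomial_le_degreeOf 0 h

lemma degreeOf_one_quarticPoly : quarticPoly.degreeOf 1 = 4 := by
  refine le_antisymm (MvPolynomial.degreeOf_le_iff.2 fun s hs => (mem_support_quarticPoly hs).2) ?_
  have h : (Finsupp.single 0 0 + Finsupp.single 1 4 : Fin 2 →₀ ℕ) ∈ quarticPoly.support := by
    rw [MvPolynomial.mem_support_iff, coeff_quarticPoly]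
    norm_num
  simpa using MvPolynomial.monomial_le_degreeOf 1 h

lemma Fhom_quarticPoly :
    Fhom 2 4 quarticPoly =
      (MvPolynomial.X 0 + MvPolynomial.X 1) ^ 2 * MvPolynomial.X 2 ^ 4
        - 2 * MvPolynomial.X 1 * (MvPolynomial.X 0 + MvPolynomial.X 1)
          * MvPolynomial.X 2 ^ 2 * MvPolynomial.X 3 ^ 2
        + 2 * MvPolynomial.X 1 ^ 2 * MvPolynomial.X 3 ^ 4 := by
  simp only [Fhom, coeff_quarticPoly, Finset.sum_range_succ, Finset.sum_range_zero]
  norm_num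
  simp only [map_ofNat]
  ring

/-- Evaluation of `ℝ[W,X,Y,Z]` at `X = 1`, viewed as polynomials in `W` over `ℝ[Y,Z]`. -/
noncomputable def dehomogenize :
    MvPolynomial (Fin 4) ℝ →ₐ[ℝ] Polynomial (MvPolynomial (Fin 2) ℝ) :=
  MvPolynomial.aeval ![Polynomial.X, 1, Polynomial.C (MvPolynomial.X 0),
    Polynomial.C (MvPolynomial.X 1)]

lemma dehomogenize_rename (p : MvPolynomial (Fin 2) ℝ) :
    dehomogenize (MvPolynomial.rename (![2, 3] : Fin 2 → Fin 4) p) = Polynomial.C p := by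
  rw [dehomogenize, MvPolynomial.aeval_rename]
  induction p using MvPolynomial.induction_on with
  | C a => simp [Polynomial.algebraMap_apply, MvPolynomial.algebraMap_eq]
  | add p q hp hq => simp only [map_add, hp, hq]
  | mul_X p i hp =>
    rw [map_mul, hp, map_mul]
    fin_cases i <;> simp

lemma coeff_dehomogenize_sum {n k : ℕ} (hk : k < n) (b : ℕ → MvPolynomial (Fin 2) ℝ)
    (e : ℕ → ℕ) :
    (dehomogenize (∑ j ∈ range n, MvPolynomial.rename (![2, 3] : Fin 2 → Fin 4) (b j) *
      MvPolynomial.X 0 ^ j * MvPolynomial.X 1 ^ e j)).coeff k = b k := by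
  have h0 : dehomogenize (MvPolynomial.X 0) = Polynomial.X := by simp [dehomogenize]
  have h1 : dehomogenize (MvPolynomial.X 1) = 1 := by simp [dehomogenize]
  simp only [map_sum, map_mul, map_pow, dehomogenize_rename, h0, h1, one_pow, mul_one,
    Polynomial.finsetSum_coeff, Polynomial.coeff_C_mul_X_pow]
  simp [hk]

lemma bFamily_quarticPoly_succ {N : ℕ} {b : ℕ → MvPolynomial (Fin 2) ℝ}
    (hb : bFamily 2 4 N quarticPoly b) :
    b (N + 1) = (MvPolynomial.X 0) ^ 2 *
      (MvPolynomial.C ((N : ℝ) + 2) * (MvPolynomial.X 0) ^ 2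
        - 2 * (MvPolynomial.X 1) ^ 2) := by
  rw [← coeff_dehomogenize_sum (show N + 1 < N + 2 + 1 by omega) b (fun j => N + 2 - j), ← hb,
    Fhom_quarticPoly]
  have h : dehomogenize ((MvPolynomial.X 0 + MvPolynomial.X 1) ^ N *
      ((MvPolynomial.X 0 + MvPolynomial.X 1) ^ 2 * MvPolynomial.X 2 ^ 4
        - 2 * MvPolynomial.X 1 * (MvPolynomial.X 0 + MvPolynomial.X 1)
          * MvPolynomial.X 2 ^ 2 * MvPolynomial.X 3 ^ 2
        + 2 * MvPolynomial.X 1 ^ 2 * MvPolynomial.X 3 ^ 4)) =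
      (Polynomial.X + 1) ^ (N + 2) * Polynomial.C (MvPolynomial.X 0 ^ 4)
        - (Polynomial.X + 1) ^ (N + 1) *
          Polynomial.C (2 * MvPolynomial.X 0 ^ 2 * MvPolynomial.X 1 ^ 2)
        + (Polynomial.X + 1) ^ N * Polynomial.C (2 * MvPolynomial.X 1 ^ 4) := by
    simp only [dehomogenize, map_mul, map_add, map_sub, map_pow, map_ofNat, MvPolynomial.aeval_X]
    simp
    ring
  rw [h]
  simp only [Polynomial.coeff_add, Polynomial.coeff_sub, Polynomial.coeff_mul_C,
    Polynomial.coeff_X_add_one_pow, Nat.choose_self, Nat.choose_succ_self,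
    show (N + 2).choose (N + 1) = N + 2 from Nat.choose_succ_self_right (N + 1)]
  simp only [map_add, map_ofNat, map_natCast]
  push_cast
  ring

lemma exists_eval_neg (N : ℕ) :
    ∃ y z : ℝ, y ^ 2 + z ^ 2 = 1 ∧
      MvPolynomial.eval ![y, z] ((MvPolynomial.X 0) ^ 2 *
        (MvPolynomial.C ((N : ℝ) + 2) * (MvPolynomial.X 0) ^ 2
          - 2 * (MvPolynomial.X 1) ^ 2)) < 0 := by
  have hN : (0 : ℝ) < N + 4 := by positivity
  have hy : √(1 / ((N : ℝ) + 4)) ^ 2 = 1 / ((N : ℝ) + 4) := Real.sq_sqrt (by positivity)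
  have hz : √(((N : ℝ) + 3) / (N + 4)) ^ 2 = ((N : ℝ) + 3) / (N + 4) :=
    Real.sq_sqrt (by positivity)
  refine ⟨√(1 / ((N : ℝ) + 4)), √(((N : ℝ) + 3) / (N + 4)), ?_, ?_⟩
  · rw [hy, hz]
    field_simp
    ring
  · simp only [map_mul, map_sub, map_pow, map_ofNat, MvPolynomial.eval_X, MvPolynomial.eval_C,
      Matrix.cons_val_zero, Matrix.cons_val_one, hy, hz]
    have h : ((N : ℝ) + 2) * (1 / (N + 4)) - 2 * ((N + 3) / (N + 4)) = -1 := by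
      field_simp
      ring
    rw [h]
    have := one_div_pos.2 hN
    linarith

lemma not_forall_eval_nonneg {N : ℕ} {b : ℕ → MvPolynomial (Fin 2) ℝ}
    (hb : bFamily 2 4 N quarticPoly b) :
    ¬ ∀ y z : ℝ, y ^ 2 + z ^ 2 = 1 → 0 ≤ MvPolynomial.eval ![y, z] (b (N + 1)) := by
  intro h
  obtain ⟨y, z, hyz, hneg⟩ := exists_eval_neg N
  have := h y z hyz
  rw [bFamily_quarticPoly_succ hb] at this
  exact hneg.not_ge this

theorem stmt_15 :
    MvPolynomial.degreeOf 0
      ((MvPolynomial.X 1) ^ 4 - 2 * MvPolynomial.X 0 * (MvPolynomial.X 1) ^ 2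
        + 2 * (MvPolynomial.X 0) ^ 2 : MvPolynomial (Fin 2) ℝ) = 2 ∧
    MvPolynomial.degreeOf 1
      ((MvPolynomial.X 1) ^ 4 - 2 * MvPolynomial.X 0 * (MvPolynomial.X 1) ^ 2
        + 2 * (MvPolynomial.X 0) ^ 2 : MvPolynomial (Fin 2) ℝ) = 4 ∧
    (∀ (N : ℕ) (b : ℕ → MvPolynomial (Fin 2) ℝ),
      bFamily 2 4 N ((MvPolynomial.X 1) ^ 4 - 2 * MvPolynomial.X 0 * (MvPolynomial.X 1) ^ 2
        + 2 * (MvPolynomial.X 0) ^ 2 : MvPolynomial (Fin 2) ℝ) b →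
      b (N + 1) = (MvPolynomial.X 0) ^ 2 *
          (MvPolynomial.C ((N : ℝ) + 2) * (MvPolynomial.X 0) ^ 2
            - 2 * (MvPolynomial.X 1) ^ 2) ∧
      ¬ ∀ y z : ℝ, y ^ 2 + z ^ 2 = 1 → 0 ≤ MvPolynomial.eval ![y, z] (b (N + 1))) ∧
    ¬ ∃ (N : ℕ) (b : ℕ → MvPolynomial (Fin 2) ℝ),
        bFamily 2 4 N ((MvPolynomial.X 1) ^ 4 - 2 * MvPolynomial.X 0 * (MvPolynomial.X 1) ^ 2
          + 2 * (MvPolynomial.X 0) ^ 2 : MvPolynomial (Fin 2) ℝ) b ∧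
        ∀ j ≤ N + 2, ∀ y z : ℝ, y ^ 2 + z ^ 2 = 1 →
          0 ≤ MvPolynomial.eval ![y, z] (b j) := by
  exact ⟨degreeOf_zero_quarticPoly, degreeOf_one_quarticPoly,
    fun _ _ hb => ⟨bFamily_quarticPoly_succ hb, not_forall_eval_nonneg hb⟩,
    fun ⟨N, _, hb, h⟩ => not_forall_eval_nonneg hb (h (N + 1) (by omega))⟩
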